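/- Let T be a tree with vertex set V, let a group Γ act on T by graph automorphisms, let s be an H-segment in T, let x ∈ V be a base vertex, and let n ≥ 1. Let κ : V^{n+1} → ℝ be bounded, Γ-invariant, and satisfy δκ = 0. Then there exists a bounded Γ-invariant function β : Γ^{n+2} → ℝ such that δβ = (δ¹f̂_{s,x}) ∪ (o_x^*κ) as functions Γ^{n+3} → ℝ; that is, for every class ζ in the image of the orbit map on degree-n bounded cohomology, the cup product [δ¹f̂_{s,x}] ∪ ζ is trivial in degree-(n+2) bounded cohomology of Γ. -/

import Mathlib

open scoped BigOperators

namespace MedianQM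

variable {V : Type*}

/-- The interval `[x,y]`: vertices on geodesics from `x` to `y`. -/
def interval (X : SimpleGraph V) (x y : V) : Set V :=
  {m | X.dist x m + X.dist m y = X.dist x y}

/-- A median graph: connected, and any three vertices admit a unique median. -/
def IsMedianGraph (X : SimpleGraph V) : Prop :=
  X.Connected ∧ ∀ x y z : V, ∃! m : V,
    m ∈ interval X x y ∧ m ∈ interval X y z ∧ m ∈ interval X x z

/-- A halfspace of `X`: the set of vertices strictly closer to one endpoint of
an edge than to the other. -/
def IsHalfspace (X : SimpleGraph V) (h : Set V) : Prop :=
  ∃ a b : V, X.Adj a b ∧ h = {v | X.dist v a < X.dist v b}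

/-- The edge `{a,b}` is dual to the halfspace `h` (equivalently, to the
hyperplane `{h, h̄}`). -/
def EdgeDual (X : SimpleGraph V) (h : Set V) (a b : V) : Prop :=
  X.Adj a b ∧
    (h = {v | X.dist v a < X.dist v b} ∨ h = {v | X.dist v b < X.dist v a})

/-- Two halfspaces are transverse. -/
def Transv (h k : Set V) : Prop :=
  (h ∩ k).Nonempty ∧ (hᶜ ∩ k).Nonempty ∧ (h ∩ kᶜ).Nonempty ∧ (hᶜ ∩ kᶜ).Nonempty

/-- `[x,y]_H`: the set of halfspaces separating `y` from `x`. -/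
def sepH (X : SimpleGraph V) (x y : V) : Set (Set V) :=
  {h | IsHalfspace X h ∧ y ∈ h ∧ x ∉ h}

/-- `X` has dimension at most `D`: every (finite) family of pairwise transverse
halfspaces has at most `D` elements. -/
def DimLE (X : SimpleGraph V) (D : ℕ) : Prop :=
  ∀ S : Finset (Set V), (∀ h ∈ S, IsHalfspace X h) →
    (∀ h ∈ S, ∀ k ∈ S, h ≠ k → Transv h k) → S.card ≤ D

/-- `h ⊋ k` are tightly nested: no halfspace lies strictly between them. -/
def TightlyNested (X : SimpleGraph V) (h k : Set V) : Prop :=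
  k ⊂ h ∧ ¬ ∃ h' : Set V, IsHalfspace X h' ∧ h' ⊂ h ∧ k ⊂ h'

/-- A staircase of length `n`. -/
def IsStaircase (X : SimpleGraph V) (n : ℕ) (h k : Fin n → Set V) : Prop :=
  (∀ i, IsHalfspace X (h i)) ∧ (∀ i, IsHalfspace X (k i)) ∧
  (∀ i j : Fin n, i < j → h j ⊂ h i) ∧ (∀ i j : Fin n, i < j → k j ⊂ k i) ∧
  (∀ i, k i ⊂ h i) ∧ (∀ i j : Fin n, j < i → Transv (h i) (k j))

/-- `X` has staircase length at most `σ`: there is no staircase of length `σ+1`. -/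
def StaircaseLE (X : SimpleGraph V) (σ : ℕ) : Prop :=
  ∀ h k : Fin (σ + 1) → Set V, ¬ IsStaircase X (σ + 1) h k

/-- An `H`-segment of length `l`: a tuple of consecutively tightly nested
halfspaces `h₁ ⊋ ⋯ ⊋ h_l`. -/
def IsHSegment (X : SimpleGraph V) (l : ℕ) (s : Fin l → Set V) : Prop :=
  (∀ i, IsHalfspace X (s i)) ∧
  ∀ i j : Fin l, (j : ℕ) = (i : ℕ) + 1 → TightlyNested X (s i) (s j)

/-- The segment `t` is contained in `[x,y]_H`. -/
def SegIn (X : SimpleGraph V) (x y : V) {l : ℕ} (t : Fin l → Set V) : Prop :=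
  ∀ i, t i ∈ sepH X x y

/-- The translate of a segment by a group element. -/
def segSMul {Γ : Type*} [SMul Γ V] (γ : Γ) {l : ℕ} (s : Fin l → Set V) :
    Fin l → Set V :=
  fun i => (γ • ·) '' s i

/-- The set of translates of `s` contained in `[x,y]_H`. -/
def translatesIn (X : SimpleGraph V) (Γ : Type*) [SMul Γ V] {l : ℕ}
    (s : Fin l → Set V) (x y : V) : Set (Fin l → Set V) :=
  {t | (∃ γ : Γ, t = segSMul γ s) ∧ SegIn X x y t}

/-- The median quasimorphism of the segment `s` (for the action of `Γ` on `X`). -/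
noncomputable def fs (X : SimpleGraph V) (Γ : Type*) [SMul Γ V] {l : ℕ}
    (s : Fin l → Set V) (x y : V) : ℝ :=
  ((translatesIn X Γ s x y).ncard : ℝ) - ((translatesIn X Γ s y x).ncard : ℝ)

/-- The coboundary of a function of two variables, evaluated on a triple. -/
noncomputable def d1 (f : V → V → ℝ) (x y z : V) : ℝ := f y z - f x z + f x y

/-- The simplicial coboundary operator. -/
noncomputable def cob {W : Type*} {m : ℕ} (β : (Fin (m + 1) → W) → ℝ) :
    (Fin (m + 2) → W) → ℝ :=
  fun x => ∑ j : Fin (m + 2), (-1 : ℝ) ^ (j : ℕ) * β (fun i => x (j.succAbove i))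

/-- Γ-invariance of a cochain. -/
def IsInvariant (Γ : Type*) {W : Type*} [SMul Γ W] {m : ℕ}
    (β : (Fin m → W) → ℝ) : Prop :=
  ∀ (γ : Γ) (x : Fin m → W), β (fun i => γ • x i) = β x

/-- Boundedness of a real-valued function. -/
def IsBounded {α : Type*} (β : α → ℝ) : Prop := ∃ C : ℝ, ∀ x, |β x| ≤ C

/-- A head of the segment `s`. -/
def IsHead (X : SimpleGraph V) {l : ℕ} (hl : 0 < l) (s : Fin l → Set V)
    (a : V) : Prop :=
  a ∉ s ⟨0, hl⟩ ∧ ∃ b, EdgeDual X (s ⟨0, hl⟩) a b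

/-- A tail of the segment `s`. -/
def IsTail (X : SimpleGraph V) {l : ℕ} (hl : 0 < l) (s : Fin l → Set V)
    (a : V) : Prop :=
  a ∈ s ⟨l - 1, by omega⟩ ∧ ∃ b, EdgeDual X (s ⟨l - 1, by omega⟩) a b

/-- The cochain `κ` is non-transverse to the segment `s`. -/
def NonTransverseTo (X : SimpleGraph V) {n l : ℕ} (hl : 0 < l)
    (κ : (Fin (n + 1) → V) → ℝ) (s : Fin l → Set V) : Prop :=
  (∀ (x : Fin n → V) (a a' : V), IsHead X hl s a → IsHead X hl s a' →
    κ (Fin.cons a x) = κ (Fin.cons a' x)) ∧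
  (∀ (x : Fin n → V) (a a' : V), IsTail X hl s a → IsTail X hl s a' →
    κ (Fin.cons a x) = κ (Fin.cons a' x))

/-- The action of `Γ` on `X` is by graph automorphisms. -/
def ActsOn (Γ : Type*) [SMul Γ V] (X : SimpleGraph V) : Prop :=
  ∀ (γ : Γ) (a b : V), X.Adj a b → X.Adj (γ • a) (γ • b)


section Halfspaces

variable {T : SimpleGraph V} {h k : Set V} {a b c d u v x y z : V}

lemma compl_closer (hT : T.IsTree) (hab : T.Adj a b) :
    {v | T.dist v a < T.dist v b}ᶜ = {v | T.dist v b < T.dist v a} := by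
  ext v
  have := hT.dist_ne_of_adj v hab
  simp only [Set.mem_compl_iff, Set.mem_ofPred_eq]
  omega

lemma IsHalfspace.compl (hT : T.IsTree) (hh : IsHalfspace T h) : IsHalfspace T hᶜ := by
  obtain ⟨a, b, hab, rfl⟩ := hh
  exact ⟨b, a, hab.symm, compl_closer hT hab⟩

lemma exists_path_closer (hT : T.IsTree) (hv : T.dist v a < T.dist v b) :
    ∃ p : T.Walk v a, p.IsPath ∧ ∀ w ∈ p.support, T.dist w a < T.dist w b := by
  classical
  obtain ⟨p, hp, hlen⟩ := hT.connected.exists_path_of_dist v a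
  refine ⟨p, hp, fun w hw => ?_⟩
  have h1 := T.dist_le (p.takeUntil w hw)
  have h2 := T.dist_le (p.dropUntil w hw)
  have h3 := congrArg SimpleGraph.Walk.length (p.take_spec hw)
  rw [SimpleGraph.Walk.length_append] at h3
  have h4 := hT.connected.dist_triangle (u := v) (v := w) (w := b)
  omega

lemma IsHalfspace.exists_walk (hT : T.IsTree) (hh : IsHalfspace T h) (hu : u ∈ h) (hv : v ∈ h) :
    ∃ p : T.Walk u v, ∀ w ∈ p.support, w ∈ h := by
  obtain ⟨a, b, hab, rfl⟩ := hh
  obtain ⟨p, -, hp⟩ := exists_path_closer hT hu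
  obtain ⟨q, -, hq⟩ := exists_path_closer hT hv
  refine ⟨p.append q.reverse, fun w hw => ?_⟩
  rw [SimpleGraph.Walk.mem_support_append_iff, SimpleGraph.Walk.support_reverse,
    List.mem_reverse] at hw
  exact hw.elim (hp w) (hq w)

lemma eq_of_crossing_closer (hT : T.IsTree) (hab : T.Adj a b) (hcd : T.Adj c d)
    (hc : T.dist c a < T.dist c b) (hd : ¬ T.dist d a < T.dist d b) : c = a ∧ d = b := by
  have hd' : T.dist d b < T.dist d a := by
    have := hT.dist_ne_of_adj d hab
    omega
  obtain ⟨p, hp, hpm⟩ := exists_path_closer hT hc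
  obtain ⟨q, hq, hqm⟩ := exists_path_closer hT hd'
  have hb : b ∉ p.support := fun hb => by simpa using hpm b hb
  have hcq : c ∉ q.support := fun h => by have := hqm c h; omega
  have key : p.concat hab = SimpleGraph.Walk.cons hcd q :=
    (hT.existsUnique_path c b).unique (hp.concat hb hab) (hq.cons hcq)
  have hsupp := congrArg SimpleGraph.Walk.support key
  rw [SimpleGraph.Walk.support_concat, SimpleGraph.Walk.support_cons] at hsupp
  constructor
  · have : a ∈ c :: q.support := by
      rw [← hsupp]
      simp
    rcases List.mem_cons.1 this with h | h
    · exact h.symm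
    · simpa using hqm a h
  · have : d ∈ p.support ++ [b] := by
      rw [hsupp]
      simp
    rw [List.mem_append, List.mem_singleton] at this
    exact this.resolve_left fun h => hd (hpm d h)

lemma IsHalfspace.crossing_unique (hT : T.IsTree) (hh : IsHalfspace T h)
    (hab : T.Adj a b) (ha : a ∈ h) (hb : b ∉ h) (hcd : T.Adj c d) (hc : c ∈ h) (hd : d ∉ h) :
    a = c ∧ b = d := by
  obtain ⟨e, f, hef, rfl⟩ := hh
  obtain ⟨rfl, rfl⟩ := eq_of_crossing_closer hT hef hab ha hb
  obtain ⟨rfl, rfl⟩ := eq_of_crossing_closer hT hef hcd hc hd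
  exact ⟨rfl, rfl⟩

lemma exists_crossing_of_walk (p : T.Walk u v) (hp : ∀ w ∈ p.support, w ∈ h)
    (hu : u ∈ k) (hv : v ∉ k) : ∃ a b, T.Adj a b ∧ a ∈ k ∧ b ∉ k ∧ a ∈ h ∧ b ∈ h := by
  obtain ⟨d, hd, h1, h2⟩ := p.exists_boundary_dart k hu hv
  exact ⟨d.fst, d.snd, d.adj, h1, h2, hp _ (p.dart_fst_mem_support_of_mem_darts hd),
    hp _ (p.dart_snd_mem_support_of_mem_darts hd)⟩

lemma IsHalfspace.subset_of_crossing (hT : T.IsTree) (hh : IsHalfspace T h)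
    (hk : IsHalfspace T k) (hab : T.Adj a b) (ha : a ∈ h) (hb : b ∉ h) (ha' : a ∈ k)
    (hb' : b ∉ k) : h ⊆ k := by
  intro u hu
  by_contra huk
  obtain ⟨p, hp⟩ := hh.exists_walk hT ha hu
  obtain ⟨c, d, hcd, hc, hd, -, hdh⟩ := exists_crossing_of_walk p hp ha' huk
  obtain ⟨rfl, rfl⟩ := hk.crossing_unique hT hab ha' hb' hcd hc hd
  exact hb hdh

lemma sepH_total (hT : T.IsTree) (hh : h ∈ sepH T x y) (hk : k ∈ sepH T x y) :
    h ⊆ k ∨ k ⊆ h := by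
  obtain ⟨hh, hy, hx⟩ := hh
  obtain ⟨hk, hy', hx'⟩ := hk
  by_contra! hcon
  obtain ⟨⟨u, huh, huk⟩, ⟨v, hvk, hvh⟩⟩ :=
    And.intro (Set.not_subset.1 hcon.1) (Set.not_subset.1 hcon.2)
  obtain ⟨p, hp⟩ := hh.exists_walk hT hy huh
  obtain ⟨q, hq⟩ := (hh.compl hT).exists_walk hT hvh hx
  obtain ⟨a, b, hab, ha, hb, hah, -⟩ := exists_crossing_of_walk p hp hy' huk
  obtain ⟨c, d, hcd, hc, hd, hch, -⟩ := exists_crossing_of_walk q hq hvk hx'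
  obtain ⟨rfl, -⟩ := hk.crossing_unique hT hab ha hb hcd hc hd
  exact hch hah

lemma sepH_finite (hT : T.IsTree) (x y : V) : (sepH T x y).Finite := by
  obtain ⟨p⟩ := hT.connected.preconnected x y
  refine ((List.finite_toSet p.darts).biUnion
    (t := fun d => {h | IsHalfspace T h ∧ d.snd ∈ h ∧ d.fst ∉ h}) fun d _ => ?_).subset ?_
  · refine Set.Subsingleton.finite fun h hh k hk => Set.Subset.antisymm ?_ ?_
    · exact hh.1.subset_of_crossing hT hk.1 d.adj.symm hh.2.1 hh.2.2 hk.2.1 hk.2.2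
    · exact hk.1.subset_of_crossing hT hh.1 d.adj.symm hk.2.1 hk.2.2 hh.2.1 hh.2.2
  · rintro h ⟨hh, hy, hx⟩
    obtain ⟨d, hd, h1, h2⟩ := p.exists_boundary_dart hᶜ hx (fun hc => hc hy)
    exact Set.mem_biUnion hd ⟨hh, not_not.1 h2, h1⟩

lemma TightlyNested.eq_right (hT : T.IsTree) {h k k' : Set V} (hk : k ∈ sepH T x y)
    (hk' : k' ∈ sepH T x y) (ht : TightlyNested T h k) (ht' : TightlyNested T h k') : k = k' := by
  by_contra hne
  rcases sepH_total hT hk hk' with hs | hs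
  · exact ht.2 ⟨k', hk'.1, ht'.1, hs.ssubset_of_ne hne⟩
  · exact ht'.2 ⟨k, hk.1, ht.1, hs.ssubset_of_ne (Ne.symm hne)⟩

lemma TightlyNested.eq_left (hT : T.IsTree) {h h' k : Set V} (hh : h ∈ sepH T x y)
    (hh' : h' ∈ sepH T x y) (ht : TightlyNested T h k) (ht' : TightlyNested T h' k) : h = h' := by
  by_contra hne
  rcases sepH_total hT hh hh' with hs | hs
  · exact ht'.2 ⟨h, hh.1, hs.ssubset_of_ne hne, ht.1⟩
  · exact ht.2 ⟨h', hh'.1, hs.ssubset_of_ne (Ne.symm hne), ht'.1⟩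

lemma TightlyNested.eq_of_split (hT : T.IsTree) {h h' k k' : Set V} (hh : h ∈ sepH T x y)
    (hh' : h' ∈ sepH T x y) (hk : k ∈ sepH T x y) (hk' : k' ∈ sepH T x y)
    (ht : TightlyNested T h k) (ht' : TightlyNested T h' k') (hz : z ∈ h) (hz' : z ∈ h')
    (hzk : z ∉ k) (hzk' : z ∉ k') : h = h' := by
  by_contra hne
  rcases sepH_total hT hh hh' with hs | hs
  · refine ht'.2 ⟨h, hh.1, hs.ssubset_of_ne hne, ?_⟩
    rcases sepH_total hT hh hk' with h1 | h1
    · exact absurd (h1 hz) hzk'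
    · exact h1.ssubset_of_ne fun he => hzk' (he ▸ hz)
  · refine ht.2 ⟨h', hh'.1, hs.ssubset_of_ne (Ne.symm hne), ?_⟩
    rcases sepH_total hT hh' hk with h1 | h1
    · exact absurd (h1 hz') hzk
    · exact h1.ssubset_of_ne fun he => hzk (he ▸ hz')

/-- Two H-segments in the same interval that agree at one place agree. -/
lemma IsHSegment.eq_of_eq_apply (hT : T.IsTree) {l : ℕ} {s t : Fin l → Set V}
    (hs : IsHSegment T l s) (ht : IsHSegment T l t) (hs' : SegIn T x y s) (ht' : SegIn T x y t)
    (i : Fin l) (hi : s i = t i) : s = t := by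
  have up : ∀ (m : ℕ) (hm : i + m < l), s ⟨i + m, hm⟩ = t ⟨i + m, hm⟩ := by
    intro m
    induction m with
    | zero => exact fun _ => hi
    | succ m ih =>
      intro hm
      have h1 := hs.2 ⟨i + m, by omega⟩ ⟨i + (m + 1), hm⟩ (by simp; omega)
      have h2 := ht.2 ⟨i + m, by omega⟩ ⟨i + (m + 1), hm⟩ (by simp; omega)
      rw [ih] at h1
      exact h1.eq_right hT (hs' _) (ht' _) h2
  have down : ∀ (m : ℕ), s ⟨i - m, by omega⟩ = t ⟨i - m, by omega⟩ := by
    intro m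
    induction m with
    | zero => exact hi
    | succ m ih =>
      by_cases hm : (i : ℕ) ≤ m
      · have : (i : ℕ) - (m + 1) = i - m := by omega
        simpa only [this] using ih
      have h1 := hs.2 ⟨i - (m + 1), by omega⟩ ⟨i - m, by omega⟩ (by simp; omega)
      have h2 := ht.2 ⟨i - (m + 1), by omega⟩ ⟨i - m, by omega⟩ (by simp; omega)
      rw [ih] at h1
      exact h1.eq_left hT (hs' _) (ht' _) h2
  funext j
  rcases le_total (i : ℕ) j with hij | hij
  · have := up (j - i) (by omega)
    simpa only [Nat.add_sub_cancel' hij] using this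
  · have := down (i - j)
    simpa only [Nat.sub_sub_self hij] using this

lemma IsHSegment.antitone {l : ℕ} {s : Fin l → Set V} (hs : IsHSegment T l s) {i j : Fin l}
    (hij : i ≤ j) : s j ⊆ s i := by
  have up : ∀ (m : ℕ) (hm : i + m < l), s ⟨i + m, hm⟩ ⊆ s i := by
    intro m
    induction m with
    | zero => exact fun _ => subset_rfl
    | succ m ih =>
      intro hm
      exact (hs.2 ⟨i + m, by omega⟩ ⟨i + (m + 1), hm⟩ (by simp; omega)).1.subset.trans
        (ih (by omega))
  have := up (j - i) (by omega)
  have hij' : (i : ℕ) ≤ j := hij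
  simpa only [Nat.add_sub_cancel' hij'] using this

lemma IsHSegment.exists_split {l : ℕ} {s : Fin l → Set V} (hs : IsHSegment T l s)
    {i j : Fin l} (hi : z ∈ s i) (hj : z ∉ s j) :
    ∃ (m : ℕ) (hm : m + 1 < l), z ∈ s ⟨m, by omega⟩ ∧ z ∉ s ⟨m + 1, hm⟩ := by
  by_contra! hcon
  have up : ∀ (m : ℕ) (hm : i + m < l), z ∈ s ⟨i + m, hm⟩ := by
    intro m
    induction m with
    | zero => exact fun _ => hi
    | succ m ih => exact fun hm => hcon (i + m) hm (ih (by omega))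
  rcases le_total i j with hij | hij
  · have := up (j - i) (by omega)
    have hij' : (i : ℕ) ≤ j := hij
    simp only [Nat.add_sub_cancel' hij'] at this
    exact hj this
  · exact hj (hs.antitone hij hi)

end Halfspaces

section Action

variable {T : SimpleGraph V} {Γ : Type*} [Group Γ] [MulAction Γ V] {h k : Set V} {a b : V}

lemma mem_image_smul_iff (γ : Γ) (h : Set V) (v : V) : v ∈ (γ • ·) '' h ↔ γ⁻¹ • v ∈ h := by
  constructor
  · rintro ⟨w, hw, rfl⟩
    simpa using hw
  · exact fun hv => ⟨_, hv, by simp⟩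

lemma ActsOn.dist_smul_le (hact : ActsOn Γ T) (hT : T.Connected) (γ : Γ) (a b : V) :
    T.dist (γ • a) (γ • b) ≤ T.dist a b := by
  obtain ⟨p, hp⟩ := hT.exists_walk_length_eq_dist a b
  let f : T →g T := ⟨fun v => γ • v, fun {a b} hab => hact γ a b hab⟩
  have := T.dist_le (p.map f)
  rwa [SimpleGraph.Walk.length_map, hp] at this

lemma ActsOn.dist_smul (hact : ActsOn Γ T) (hT : T.Connected) (γ : Γ) (a b : V) :
    T.dist (γ • a) (γ • b) = T.dist a b := by
  refine le_antisymm (hact.dist_smul_le hT γ a b) ?_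
  simpa using hact.dist_smul_le hT γ⁻¹ (γ • a) (γ • b)

lemma IsHalfspace.image_smul (hact : ActsOn Γ T) (hT : T.Connected) (hh : IsHalfspace T h)
    (γ : Γ) : IsHalfspace T ((γ • ·) '' h) := by
  obtain ⟨a, b, hab, rfl⟩ := hh
  refine ⟨γ • a, γ • b, hact γ a b hab, ?_⟩
  ext v
  rw [mem_image_smul_iff]
  have (c : V) : T.dist (γ⁻¹ • v) c = T.dist v (γ • c) := by
    simpa using hact.dist_smul hT γ⁻¹ v (γ • c)
  simp [this]

lemma image_smul_ssubset (γ : Γ) (hkh : k ⊂ h) : (γ • ·) '' k ⊂ (γ • ·) '' h :=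
  (MulAction.injective γ).image_strictMono hkh

lemma image_smul_inv_image_smul (γ : Γ) (h : Set V) : (γ⁻¹ • ·) '' ((γ • ·) '' h) = h := by
  simp [Set.image_image]

lemma TightlyNested.image_smul (hact : ActsOn Γ T) (hT : T.Connected) (ht : TightlyNested T h k)
    (γ : Γ) : TightlyNested T ((γ • ·) '' h) ((γ • ·) '' k) := by
  refine ⟨image_smul_ssubset γ ht.1, ?_⟩
  rintro ⟨h', hh', h1, h2⟩
  have h1 := image_smul_ssubset γ⁻¹ h1
  have h2 := image_smul_ssubset γ⁻¹ h2
  rw [image_smul_inv_image_smul] at h1 h2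
  exact ht.2 ⟨_, hh'.image_smul hact hT γ⁻¹, h1, h2⟩

lemma IsHSegment.segSMul (hact : ActsOn Γ T) (hT : T.Connected) {l : ℕ} {s : Fin l → Set V}
    (hs : IsHSegment T l s) (γ : Γ) : IsHSegment T l (segSMul γ s) :=
  ⟨fun i => (hs.1 i).image_smul hact hT γ, fun i j hij => (hs.2 i j hij).image_smul hact hT γ⟩

lemma segSMul_mul (γ γ' : Γ) {l : ℕ} (s : Fin l → Set V) :
    segSMul γ (segSMul γ' s) = segSMul (γ * γ') s := by
  funext i
  simp [segSMul, Set.image_image, mul_smul]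

lemma segSMul_inv_segSMul (γ : Γ) {l : ℕ} (s : Fin l → Set V) :
    segSMul γ⁻¹ (segSMul γ s) = s := by
  funext i
  exact image_smul_inv_image_smul γ (s i)

lemma segSMul_injective (γ : Γ) (l : ℕ) :
    Function.Injective (segSMul γ : (Fin l → Set V) → Fin l → Set V) :=
  Function.LeftInverse.injective (segSMul_inv_segSMul γ)

lemma segSMul_mem_translatesIn (hact : ActsOn Γ T) (hT : T.Connected) {l : ℕ}
    {s t : Fin l → Set V} {x y : V} (ht : t ∈ translatesIn T Γ s x y) (γ : Γ) :
    segSMul γ t ∈ translatesIn T Γ s (γ • x) (γ • y) := by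
  obtain ⟨⟨γ', rfl⟩, ht⟩ := ht
  refine ⟨⟨γ * γ', segSMul_mul γ γ' s⟩, fun i => ⟨(ht i).1.image_smul hact hT γ, ?_, ?_⟩⟩
  · exact ⟨y, (ht i).2.1, rfl⟩
  · simpa only [segSMul, mem_image_smul_iff, inv_smul_smul] using (ht i).2.2

lemma translatesIn_smul (hact : ActsOn Γ T) (hT : T.Connected) {l : ℕ}
    (s : Fin l → Set V) (x y : V) (γ : Γ) :
    translatesIn T Γ s (γ • x) (γ • y) = segSMul γ '' translatesIn T Γ s x y := by
  refine Set.Subset.antisymm (fun t ht => ⟨segSMul γ⁻¹ t, ?_, ?_⟩) ?_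
  · simpa using segSMul_mem_translatesIn hact hT ht γ⁻¹
  · simpa using segSMul_inv_segSMul γ⁻¹ t
  · rintro _ ⟨t, ht, rfl⟩
    exact segSMul_mem_translatesIn hact hT ht γ

/-- The endpoint inside `h` of an edge leaving `h`. -/
noncomputable def innerEnd (T : SimpleGraph V) [Nonempty V] (h : Set V) : V :=
  Classical.epsilon fun a => a ∈ h ∧ ∃ b ∉ h, T.Adj a b

lemma innerEnd_image_smul [Nonempty V] (hT : T.IsTree) (hact : ActsOn Γ T) (hh : IsHalfspace T h)
    (γ : Γ) : innerEnd T ((γ • ·) '' h) = γ • innerEnd T h := by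
  have spec : ∀ k : Set V, IsHalfspace T k → innerEnd T k ∈ k ∧ ∃ b ∉ k, T.Adj (innerEnd T k) b := by
    rintro k ⟨a, b, hab, rfl⟩
    refine Classical.epsilon_spec (p := fun c => c ∈ _ ∧ ∃ d ∉ _, T.Adj c d) ⟨a, ?_, b, ?_, hab⟩
    · simpa using hT.connected.pos_dist_of_ne hab.ne
    · simp
  have hγ := hh.image_smul hact hT.connected γ
  obtain ⟨ha, b, hb, hab⟩ := spec h hh
  obtain ⟨hc, d, hd, hcd⟩ := spec _ hγ
  refine (hγ.crossing_unique hT hcd hc hd (hact γ _ _ hab) ⟨_, ha, rfl⟩ (d := γ • b) ?_).1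
  rw [mem_image_smul_iff]
  simpa using hb

end Action

section WeightedCount

variable {T : SimpleGraph V} {Γ : Type*} [Group Γ] [MulAction Γ V] {l : ℕ}
  {s : Fin l → Set V} {x y z : V} {g : (Fin l → Set V) → ℝ} {C : ℝ}

lemma translatesIn_finite (hT : T.IsTree) (s : Fin l → Set V) (x y : V) :
    (translatesIn T Γ s x y).Finite :=
  (Set.Finite.pi' fun _ => sepH_finite hT x y).subset fun _ ht => ht.2

/-- The sum of the weights of the translates of `s` contained in `[x,y]_H`, minus the sum of the
weights of those contained in `[y,x]_H`. -/
noncomputable def weightedFs (T : SimpleGraph V) (Γ : Type*) [SMul Γ V] (s : Fin l → Set V)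
    (g : (Fin l → Set V) → ℝ) (x y : V) : ℝ :=
  ∑ᶠ t ∈ translatesIn T Γ s x y, g t - ∑ᶠ t ∈ translatesIn T Γ s y x, g t

lemma weightedFs_const (hT : T.IsTree) (c : ℝ) :
    weightedFs T Γ s (fun _ => c) x y = fs T Γ s x y * c := by
  have key (x y : V) : ∑ᶠ t ∈ translatesIn T Γ s x y, c = (translatesIn T Γ s x y).ncard * c := by
    rw [finsum_mem_eq_finite_toFinset_sum _ (translatesIn_finite hT s x y), Finset.sum_const,
      nsmul_eq_mul, Set.ncard_eq_toFinset_card _ (translatesIn_finite hT s x y)]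
  rw [weightedFs, key, key, fs, sub_mul]

lemma weightedFs_sub (hT : T.IsTree) (g g' : (Fin l → Set V) → ℝ) :
    weightedFs T Γ s (fun t => g t - g' t) x y =
      weightedFs T Γ s g x y - weightedFs T Γ s g' x y := by
  simp only [weightedFs, finsum_mem_eq_finite_toFinset_sum _ (translatesIn_finite hT s _ _),
    Finset.sum_sub_distrib]
  ring

lemma weightedFs_sum (hT : T.IsTree) {ι : Type*} [Fintype ι] (c : ι → ℝ)
    (g : ι → (Fin l → Set V) → ℝ) :
    weightedFs T Γ s (fun t => ∑ i, c i * g i t) x y =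
      ∑ i, c i * weightedFs T Γ s (g i) x y := by
  simp only [weightedFs, finsum_mem_eq_finite_toFinset_sum _ (translatesIn_finite hT s _ _),
    mul_sub, Finset.sum_sub_distrib, Finset.mul_sum]
  rw [Finset.sum_comm, Finset.sum_comm (t := (translatesIn_finite hT s y x).toFinset)]

lemma weightedFs_congr {g' : (Fin l → Set V) → ℝ}
    (hg : ∀ t, (∀ i, IsHalfspace T (t i)) → g t = g' t) :
    weightedFs T Γ s g x y = weightedFs T Γ s g' x y := by
  have (x y : V) : ∑ᶠ t ∈ translatesIn T Γ s x y, g t = ∑ᶠ t ∈ translatesIn T Γ s x y, g' t :=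
    finsum_mem_congr rfl fun t ht => hg t fun i => (ht.2 i).1
  rw [weightedFs, this, this, weightedFs]

lemma weightedFs_smul (hact : ActsOn Γ T) (hT : T.Connected) (γ : Γ) :
    weightedFs T Γ s g (γ • x) (γ • y) = weightedFs T Γ s (fun t => g (segSMul γ t)) x y := by
  rw [weightedFs, translatesIn_smul hact hT, translatesIn_smul hact hT,
    finsum_mem_image (segSMul_injective γ l).injOn,
    finsum_mem_image (segSMul_injective γ l).injOn, weightedFs]

lemma fs_smul (hT : T.IsTree) (hact : ActsOn Γ T) (s : Fin l → Set V) (γ : Γ) (x y : V) :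
    fs T Γ s (γ • x) (γ • y) = fs T Γ s x y := by
  have h (x y : V) := weightedFs_const (Γ := Γ) (s := s) (x := x) (y := y) hT 1
  simp only [mul_one] at h
  rw [← h, ← h, weightedFs_smul hact hT.connected]

/-- At most `l` translates in `[x,y]_H` are cut by `z`. -/
lemma ncard_split_le (hT : T.IsTree) (hact : ActsOn Γ T) (hs : IsHSegment T l s) :
    {t ∈ translatesIn T Γ s x y | ∃ i j, z ∈ t i ∧ z ∉ t j}.ncard ≤ l := by
  set B := {t ∈ translatesIn T Γ s x y | ∃ i j, z ∈ t i ∧ z ∉ t j}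
  have hseg (t : B) : IsHSegment T l t.1 := by
    obtain ⟨t, ⟨⟨γ, rfl⟩, -⟩, -⟩ := t
    exact hs.segSMul hact hT.connected γ
  have hex (t : B) : ∃ (m : Fin l) (hm : (m : ℕ) + 1 < l), z ∈ t.1 m ∧ z ∉ t.1 ⟨m + 1, hm⟩ := by
    obtain ⟨i, j, hi, hj⟩ := t.2.2
    obtain ⟨m, hm, h1, h2⟩ := (hseg t).exists_split hi hj
    exact ⟨⟨m, by omega⟩, hm, h1, h2⟩
  choose f hf hf1 hf2 using hex
  have hinj : Function.Injective f := by
    intro t t' htt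
    refine Subtype.ext ((hseg t).eq_of_eq_apply hT (hseg t') t.2.1.2 t'.2.1.2 (f t) ?_)
    have ht1 := hf1 t'
    have ht2 := hf2 t'
    simp only [← htt] at ht1 ht2
    exact TightlyNested.eq_of_split hT (t.2.1.2 _) (t'.2.1.2 _) (t.2.1.2 _) (t'.2.1.2 _)
      ((hseg t).2 (f t) ⟨f t + 1, hf t⟩ rfl) ((hseg t').2 (f t) ⟨f t + 1, hf t⟩ rfl)
      (hf1 t) ht1 (hf2 t) ht2
  simpa using Nat.card_le_card_of_injective f hinj

lemma abs_finsum_mem_le {α : Type*} {S : Set α} (hS : S.Finite) {g : α → ℝ}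
    (hg : ∀ t, |g t| ≤ C) : |∑ᶠ t ∈ S, g t| ≤ S.ncard * C := by
  rw [finsum_mem_eq_finite_toFinset_sum _ hS, Set.ncard_eq_toFinset_card _ hS, ← nsmul_eq_mul]
  exact (Finset.abs_sum_le_sum_abs _ _).trans (Finset.sum_le_card_nsmul _ _ _ fun t _ => hg t)

lemma finsum_translatesIn_eq_add (hT : T.IsTree) (hl : 1 ≤ l) (s : Fin l → Set V)
    (g : (Fin l → Set V) → ℝ) (x y z : V) :
    ∑ᶠ t ∈ translatesIn T Γ s x y, g t =
      ∑ᶠ t ∈ {t ∈ translatesIn T Γ s x y | ∀ i, z ∈ t i}, g t +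
      ∑ᶠ t ∈ {t ∈ translatesIn T Γ s x y | ∀ i, z ∉ t i}, g t +
      ∑ᶠ t ∈ {t ∈ translatesIn T Γ s x y | ∃ i j, z ∈ t i ∧ z ∉ t j}, g t := by
  have hfin (p : (Fin l → Set V) → Prop) : {t ∈ translatesIn T Γ s x y | p t}.Finite :=
    (translatesIn_finite hT s x y).subset (Set.sep_subset _ _)
  rw [← finsum_mem_union _ (hfin _) (hfin _), ← finsum_mem_union _ ((hfin _).union (hfin _)) (hfin _)]
  · refine finsum_mem_congr (Set.ext fun t => ?_) fun _ _ => rfl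
    simp only [Set.mem_union, Set.mem_ofPred_eq]
    grind
  · rw [Set.disjoint_left]
    rintro t (⟨-, h⟩ | ⟨-, h⟩) ⟨-, i, j, hi, hj⟩
    · exact hj (h j)
    · exact h i hi
  · rw [Set.disjoint_left]
    rintro t ⟨-, h⟩ ⟨-, h'⟩
    exact h' ⟨0, hl⟩ (h _)

lemma sep_mem_comm (s : Fin l → Set V) (x y z : V) :
    {t ∈ translatesIn T Γ s x y | ∀ i, z ∈ t i} = {t ∈ translatesIn T Γ s x z | ∀ i, y ∈ t i} := by
  ext t
  simp only [translatesIn, SegIn, sepH, Set.mem_ofPred_eq]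
  grind

lemma sep_notMem_comm (s : Fin l → Set V) (x y z : V) :
    {t ∈ translatesIn T Γ s x y | ∀ i, z ∉ t i} = {t ∈ translatesIn T Γ s z y | ∀ i, x ∉ t i} := by
  ext t
  simp only [translatesIn, SegIn, sepH, Set.mem_ofPred_eq]
  grind

lemma abs_weightedFs_triangle_le (hT : T.IsTree) (hact : ActsOn Γ T) (hl : 1 ≤ l)
    (hs : IsHSegment T l s) (hg : ∀ t, |g t| ≤ C) (x y z : V) :
    |weightedFs T Γ s g y z - weightedFs T Γ s g x z + weightedFs T Γ s g x y| ≤ 6 * (l * C) := by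
  have hC : 0 ≤ C := (abs_nonneg _).trans (hg s)
  have bound (x y z : V) :
      |∑ᶠ t ∈ {t ∈ translatesIn T Γ s x y | ∃ i j, z ∈ t i ∧ z ∉ t j}, g t| ≤ l * C :=
    (abs_finsum_mem_le ((translatesIn_finite hT s x y).subset (Set.sep_subset _ _)) hg).trans <|
      mul_le_mul_of_nonneg_right (Nat.cast_le.2 (ncard_split_le hT hact hs)) hC
  simp only [weightedFs]
  rw [finsum_translatesIn_eq_add hT hl s g x y z, finsum_translatesIn_eq_add hT hl s g y x z,
    finsum_translatesIn_eq_add hT hl s g y z x, finsum_translatesIn_eq_add hT hl s g z y x,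
    finsum_translatesIn_eq_add hT hl s g z x y, finsum_translatesIn_eq_add hT hl s g x z y,
    sep_mem_comm s x y z, sep_mem_comm s y x z, sep_mem_comm s z x y,
    sep_notMem_comm s x y z, sep_notMem_comm s y x z, sep_notMem_comm s x z y]
  have h1 := abs_le.1 (bound x y z)
  have h2 := abs_le.1 (bound y x z)
  have h3 := abs_le.1 (bound y z x)
  have h4 := abs_le.1 (bound z y x)
  have h5 := abs_le.1 (bound z x y)
  have h6 := abs_le.1 (bound x z y)
  exact abs_le.2 ⟨by linarith, by linarith⟩

end WeightedCount

section Coboundary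

variable {W : Type*}

lemma cob_add {m : ℕ} (β β' : (Fin (m + 1) → W) → ℝ) (X : Fin (m + 2) → W) :
    cob (fun Y => β Y + β' Y) X = cob β X + cob β' X := by
  simp [cob, mul_add, Finset.sum_add_distrib]

lemma cob_sub {m : ℕ} (β β' : (Fin (m + 1) → W) → ℝ) (X : Fin (m + 2) → W) :
    cob (fun Y => β Y - β' Y) X = cob β X - cob β' X := by
  simp [cob, mul_sub, Finset.sum_sub_distrib]

lemma cons_comp_succAbove_succ {m : ℕ} (a : W) (X : Fin (m + 1) → W) (j : Fin (m + 1)) :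
    (fun i => (Fin.cons a X : Fin (m + 2) → W) (j.succ.succAbove i)) =
      (Fin.cons a (fun i => X (j.succAbove i)) : Fin (m + 1) → W) := by
  funext i
  refine Fin.cases ?_ (fun i => ?_) i <;> simp

lemma cob_cons {m : ℕ} (β : (Fin (m + 1) → W) → ℝ) (a : W) (X : Fin (m + 1) → W) :
    cob β (Fin.cons a X : Fin (m + 2) → W) =
      β X - ∑ j : Fin (m + 1), (-1 : ℝ) ^ (j : ℕ) *
        β (Fin.cons a (fun i => X (j.succAbove i)) : Fin (m + 1) → W) := by
  rw [cob, Fin.sum_univ_succ]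
  simp only [cons_comp_succAbove_succ, Fin.val_succ, pow_succ, Fin.zero_succAbove, Fin.cons_succ]
  simp [sub_eq_add_neg]

lemma cob_cons_cons {m : ℕ} (β : (Fin (m + 2) → W) → ℝ) (a b : W) (X : Fin (m + 1) → W) :
    cob β (Fin.cons a (Fin.cons b X : Fin (m + 2) → W) : Fin (m + 3) → W) =
      β (Fin.cons b X) - β (Fin.cons a X) + ∑ j : Fin (m + 1), (-1 : ℝ) ^ (j : ℕ) *
        β (Fin.cons a (Fin.cons b (fun i => X (j.succAbove i)) : Fin (m + 1) → W)) := by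
  rw [cob_cons]
  have := cob_cons (fun Y => β (Fin.cons a Y)) b X
  rw [cob] at this
  rw [this]
  ring

lemma cob_cob {m : ℕ} (β : (Fin (m + 1) → W) → ℝ) (X : Fin (m + 3) → W) : cob (cob β) X = 0 := by
  induction m with
  | zero =>
    induction X using Fin.consCases with | _ a X =>
    have h (j : Fin 2) := cob_cons β a (fun i => X (j.succAbove i))
    simp only [Subsingleton.elim _ (default : Fin 0 → W)]
      at h
    rw [cob_cons]
    simp only [h]
    simp [cob, Fin.sum_univ_two]
  | succ m ih =>
    induction X using Fin.consCases with | _ a X =>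
    have h1 : (fun Y : Fin (m + 2) → W => cob β (Fin.cons a Y)) =
        fun Y => β Y - cob (fun Z => β (Fin.cons a Z)) Y := by
      funext Y
      rw [cob_cons, cob]
    have h2 := cob_cons (cob β) a X
    rw [h2]
    change cob β X - cob (fun Y : Fin (m + 2) → W => cob β (Fin.cons a Y)) X = 0
    rw [h1, cob_sub, ih]
    ring

lemma cob_cup {m : ℕ} (f : W → W → ℝ) (κ : (Fin (m + 1) → W) → ℝ) (hκ : cob κ = 0)
    (X : Fin (m + 3) → W) :
    cob (fun Y : Fin (m + 2) → W => f (Y 0) (Y 1) * κ (fun i => Y i.succ)) X =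
      d1 f (X 0) (X 1) (X 2) * κ (fun i => X i.succ.succ) := by
  induction X using Fin.consCases with | _ a X =>
  induction X using Fin.consCases with | _ b X =>
  have h := congrFun hκ (Fin.cons b X)
  rw [cob_cons] at h
  rw [cob_cons_cons]
  have e2 : (2 : Fin (m + 3)) = Fin.succ (Fin.succ 0) := rfl
  have e1 : (1 : Fin (m + 3)) = Fin.succ 0 := rfl
  have e1' : (1 : Fin (m + 2)) = Fin.succ 0 := rfl
  simp only [e1, e2, e1', Fin.cons_zero, Fin.cons_succ, d1]
  simp only [Pi.zero_apply] at h
  simp only [mul_left_comm _ (f a b), ← Finset.mul_sum]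
  linear_combination (-f a b) * h

lemma IsInvariant.cob {Γ : Type*} [SMul Γ W] {m : ℕ} {β : (Fin (m + 1) → W) → ℝ} (hβ : IsInvariant Γ β) :
    IsInvariant Γ (cob β) := by
  intro γ X
  simp only [MedianQM.cob]
  exact Finset.sum_congr rfl fun j _ => by rw [← hβ γ fun i => X (j.succAbove i)]

end Coboundary

section Primitive

variable {T : SimpleGraph V} {Γ : Type*} [Group Γ] [MulAction Γ V] [Nonempty V] {l m : ℕ}

/-- The weighted count of translates of `s` between `x` and `y`, each translate being weighted by
the value of `κ` at the inner end of its first halfspace followed by `Z`. -/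
noncomputable def segmentSum (T : SimpleGraph V) (Γ : Type*) [Group Γ] [MulAction Γ V]
    (hl : 1 ≤ l) (s : Fin l → Set V) (κ : (Fin (m + 1) → V) → ℝ) (x y : V) (Z : Fin m → V) : ℝ :=
  weightedFs T Γ s (fun t => κ (Fin.cons (innerEnd T (t ⟨0, hl⟩)) Z)) x y

/-- The `Γ`-invariant cochain correcting `f_s ∪ κ` to a bounded cochain. -/
noncomputable def correction (T : SimpleGraph V) (Γ : Type*) [Group Γ] [MulAction Γ V]
    (hl : 1 ≤ l) (s : Fin l → Set V) (κ : (Fin (m + 2) → V) → ℝ) (X : Fin (m + 2) → V) : ℝ :=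
  segmentSum T Γ hl s κ (X 0) (X 1) (fun i => X i.succ)

lemma segmentSum_smul (hT : T.IsTree) (hact : ActsOn Γ T) (hl : 1 ≤ l) (s : Fin l → Set V)
    (κ : (Fin (m + 1) → V) → ℝ) (hκ : IsInvariant Γ κ) (γ : Γ) (x y : V) (Z : Fin m → V) :
    segmentSum T Γ hl s κ (γ • x) (γ • y) (fun i => γ • Z i) = segmentSum T Γ hl s κ x y Z := by
  rw [segmentSum, weightedFs_smul hact hT.connected]
  refine weightedFs_congr fun t ht => ?_
  conv_rhs => rw [← hκ γ]
  rw [segSMul, innerEnd_image_smul hT hact (ht _)]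
  congr 1
  funext i
  refine Fin.cases ?_ (fun i => ?_) i <;> simp

lemma cob_correction (hT : T.IsTree) (hl : 1 ≤ l) (s : Fin l → Set V)
    (κ : (Fin (m + 2) → V) → ℝ) (hκ : cob κ = 0) (a b : V) (Z : Fin (m + 1) → V) :
    cob (correction T Γ hl s κ) (Fin.cons a (Fin.cons b Z : Fin (m + 2) → V)) =
      segmentSum T Γ hl s κ b (Z 0) Z - segmentSum T Γ hl s κ a (Z 0) Z +
        segmentSum T Γ hl s κ a b Z - fs T Γ s a b * κ (Fin.cons b Z) := by
  have h (p : V) : ∑ j : Fin (m + 1), (-1 : ℝ) ^ (j : ℕ) *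
      κ (Fin.cons p (Fin.cons b (fun i => Z (j.succAbove i)) : Fin (m + 1) → V)) =
        κ (Fin.cons p Z) - κ (Fin.cons b Z) := by
    have := congrFun hκ (Fin.cons p (Fin.cons b Z : Fin (m + 2) → V))
    rw [cob_cons_cons, Pi.zero_apply] at this
    linear_combination this
  rw [cob_cons_cons]
  have e1 : (1 : Fin (m + 2)) = Fin.succ 0 := rfl
  simp only [correction, e1, Fin.cons_zero, Fin.cons_succ]
  rw [show ∑ j : Fin (m + 1), (-1 : ℝ) ^ (j : ℕ) * segmentSum T Γ hl s κ a b
      (Fin.cons b (fun i => Z (j.succAbove i)) : Fin (m + 1) → V) =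
        segmentSum T Γ hl s κ a b Z - fs T Γ s a b * κ (Fin.cons b Z) by
    simp only [segmentSum]
    rw [← weightedFs_sum hT, ← weightedFs_const hT, ← weightedFs_sub hT]
    simp only [h]]
  ring

theorem exists_bounded_primitive {s : Fin l → Set V} (hT : T.IsTree) (hact : ActsOn Γ T)
    (hl : 1 ≤ l) (hs : IsHSegment T l s) (κ : (Fin (m + 2) → V) → ℝ) (hκb : IsBounded κ)
    (hκinv : IsInvariant Γ κ) (hκ : cob κ = 0) :
    ∃ β : (Fin (m + 3) → V) → ℝ, IsBounded β ∧ IsInvariant Γ β ∧ ∀ X : Fin (m + 4) → V,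
      cob β X = d1 (fs T Γ s) (X 0) (X 1) (X 2) * κ (fun i => X i.succ.succ) := by
  obtain ⟨C, hC⟩ := hκb
  refine ⟨fun Y => fs T Γ s (Y 0) (Y 1) * κ (fun i => Y i.succ) + cob (correction T Γ hl s κ) Y,
    ⟨6 * (l * C), fun Y => ?_⟩, fun γ Y => ?_, fun X => ?_⟩
  · induction Y using Fin.consCases with | _ a Y =>
    induction Y using Fin.consCases with | _ b Z =>
    have e1 : (1 : Fin (m + 3)) = Fin.succ 0 := rfl
    simp only [e1, Fin.cons_zero, Fin.cons_succ]
    rw [cob_correction hT hl s κ hκ, add_sub_cancel]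
    exact abs_weightedFs_triangle_le hT hact hl hs (fun t => hC _) a b (Z 0)
  · have hcorr : IsInvariant Γ (correction T Γ hl s κ) := fun γ X =>
      segmentSum_smul hT hact hl s κ hκinv γ _ _ _
    simp only
    rw [fs_smul hT hact, hcorr.cob γ Y, hκinv γ fun i => Y i.succ]
  · rw [cob_add, cob_cob, add_zero, cob_cup _ κ hκ]

end Primitive

/-- Corollary `cor:maintreegroup`: for a group acting on a tree `T`,
an H-segment `s`, a base vertex `x` and `n ≥ 1`, every bounded Γ-invariant cocycle `κ`
on `V^{n+1}` satisfies: `(δ¹f̂_{s,x}) ∪ (o_x^*κ)` has a bounded Γ-invariant primitive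
on `Γ`; i.e. the cup product `[δ¹f̂_{s,x}] ∪ ζ` vanishes in degree-(n+2) bounded
cohomology of `Γ` for every `ζ` in the image of the orbit map. -/
theorem statement7 {V : Type*} (T : SimpleGraph V) (hT : T.IsTree)
    (Γ : Type*) [Group Γ] [MulAction Γ V] (hact : ActsOn Γ T)
    (l : ℕ) (hl : 1 ≤ l) (s : Fin l → Set V) (hseg : IsHSegment T l s)
    (x : V) (n : ℕ) (hn : 1 ≤ n) (κ : (Fin (n + 1) → V) → ℝ)
    (hκb : IsBounded κ) (hκinv : IsInvariant Γ κ) (hκcoc : cob κ = 0) :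
    ∃ β : (Fin (n + 2) → Γ) → ℝ, IsBounded β ∧ IsInvariant Γ β ∧
      ∀ g : Fin (n + 3) → Γ,
        cob β g =
          d1 (fun γ₀ γ₁ : Γ => fs T Γ s (γ₀ • x) (γ₁ • x)) (g 0) (g 1) (g 2) *
            κ (fun i => (g ⟨2 + (i : ℕ), by have := i.isLt; omega⟩) • x) := by
  obtain ⟨m, rfl⟩ : ∃ m, n = m + 1 := ⟨n - 1, by omega⟩
  have : Nonempty V := ⟨x⟩
  obtain ⟨β, ⟨C, hC⟩, hβinv, hβ⟩ :=
    exists_bounded_primitive hT hact hl hseg κ hκb hκinv hκcoc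
  refine ⟨fun g => β fun i => g i • x, ⟨C, fun g => hC _⟩, fun γ g => ?_, fun g => ?_⟩
  · simpa only [smul_eq_mul, mul_smul] using hβinv γ fun i => g i • x
  · refine (hβ fun i => g i • x).trans ?_
    simp only [d1]
    congr 2
    funext i
    congr 2
    ext
    simp only [Fin.val_succ]
    omega

end MedianQM
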